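/- Weighted momentum monotonicity: for a smooth compactly supported (modulo constants) wave map φ : I × R² → S^m and a bump χ equal to 1 on the unit ball, d/dt ∫_{R²} Σ_{i=1,2} x_i χ(x/R) ∂_t φ^† ∂_i φ dx = −∫_{R²} |∂_t φ|² dx + O(r(R)), where r(R) = ∫_{|x|≥R} Σ_{α=0}^{2} |∂_α φ|² dx and the implied constant is absolute. -/

import Mathlib

open MeasureTheory
open scoped RealInnerProductSpace

noncomputable section

abbrev E2 : Type := EuclideanSpace ℝ (Fin 2)
abbrev Em (m : ℕ) : Type := EuclideanSpace ℝ (Fin (m+1))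

noncomputable def ptD {F : Type*} [NormedAddCommGroup F] [NormedSpace ℝ F]
    (u : ℝ × E2 → F) (p : ℝ × E2) : F :=
  fderiv ℝ u p (1, 0)

noncomputable def pxD {F : Type*} [NormedAddCommGroup F] [NormedSpace ℝ F]
    (i : Fin 2) (u : ℝ × E2 → F) (p : ℝ × E2) : F :=
  fderiv ℝ u p (0, EuclideanSpace.single i (1:ℝ))

noncomputable def boxD {F : Type*} [NormedAddCommGroup F] [NormedSpace ℝ F]
    (u : ℝ × E2 → F) (p : ℝ × E2) : F :=
  -(ptD (fun q => ptD u q) p) + ∑ i : Fin 2, pxD i (fun q => pxD i u q) p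

noncomputable def nullf (m : ℕ) (φ : ℝ × E2 → Em m) (p : ℝ × E2) : ℝ :=
  -⟪ptD φ p, ptD φ p⟫ + ∑ i : Fin 2, ⟪pxD i φ p, pxD i φ p⟫

noncomputable def eden (m : ℕ) (φ : ℝ × E2 → Em m) (t : ℝ) (x : E2) : ℝ :=
  ‖ptD φ (t, x)‖^2 + ∑ i : Fin 2, ‖pxD i φ (t, x)‖^2

lemma contDiff_ptD {F : Type*} [NormedAddCommGroup F] [NormedSpace ℝ F] {u : ℝ × E2 → F}
    (hu : ContDiff ℝ (⊤ : ℕ∞) u) : ContDiff ℝ (⊤ : ℕ∞) (ptD u) :=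
  (hu.fderiv_right (m := (⊤ : ℕ∞)) (by simp)).clm_apply contDiff_const

lemma contDiff_pxD {F : Type*} [NormedAddCommGroup F] [NormedSpace ℝ F] {u : ℝ × E2 → F}
    (hu : ContDiff ℝ (⊤ : ℕ∞) u) (i : Fin 2) : ContDiff ℝ (⊤ : ℕ∞) (pxD i u) :=
  (hu.fderiv_right (m := (⊤ : ℕ∞)) (by simp)).clm_apply contDiff_const

lemma fderiv_fderiv_comm {F : Type*} [NormedAddCommGroup F] [NormedSpace ℝ F] {u : ℝ × E2 → F}
    (hu : ContDiff ℝ (⊤ : ℕ∞) u) (p v w : ℝ × E2) :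
    fderiv ℝ (fun q => fderiv ℝ u q v) p w = fderiv ℝ (fun q => fderiv ℝ u q w) p v := by
  have hd : DifferentiableAt ℝ (fderiv ℝ u) p :=
    ((hu.fderiv_right (m := (⊤ : ℕ∞)) (by simp)).differentiable (by simp)) p
  have hs : IsSymmSndFDerivAt ℝ u p :=
    hu.contDiffAt.isSymmSndFDerivAt (by simpa using WithTop.coe_le_coe.2 (le_top : (2 : ℕ∞) ≤ ⊤))
  rw [fderiv_clm_apply hd (by fun_prop), fderiv_clm_apply hd (by fun_prop)]
  simpa using hs w v

lemma pxD_ptD {F : Type*} [NormedAddCommGroup F] [NormedSpace ℝ F] {u : ℝ × E2 → F}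
    (hu : ContDiff ℝ (⊤ : ℕ∞) u) (i : Fin 2) (p : ℝ × E2) :
    pxD i (ptD u) p = ptD (pxD i u) p :=
  fderiv_fderiv_comm hu p _ _

lemma pxD_pxD {F : Type*} [NormedAddCommGroup F] [NormedSpace ℝ F] {u : ℝ × E2 → F}
    (hu : ContDiff ℝ (⊤ : ℕ∞) u) (i j : Fin 2) (p : ℝ × E2) :
    pxD i (pxD j u) p = pxD j (pxD i u) p :=
  fderiv_fderiv_comm hu p _ _

/-- Differentiation under the integral for a smooth function whose time slices near `t` vanish
off a common ball. -/
lemma hasDerivAt_integral_slice {G : ℝ × E2 → ℝ} (hG : ContDiff ℝ (⊤ : ℕ∞) G) {t ε ρ : ℝ}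
    (hε : 0 < ε) (h0 : ∀ s, |s - t| < ε → ∀ x : E2, ρ ≤ ‖x‖ → G (s, x) = 0) :
    Integrable (fun x : E2 => ptD G (t, x)) ∧
      HasDerivAt (fun s => ∫ x : E2, G (s, x)) (∫ x : E2, ptD G (t, x)) t := by
  have hc : Continuous (ptD G) := (contDiff_ptD hG).continuous
  have hd : ∀ s x, HasDerivAt (fun s => G (s, x)) (ptD G (s, x)) s := fun s x =>
    ((hG.differentiable (by simp) (s, x)).hasFDerivAt).comp_hasDerivAt s
      ((hasDerivAt_id s).prodMk (hasDerivAt_const s x))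
  have hK : IsCompact (Set.Icc (t - ε) (t + ε) ×ˢ Metric.closedBall (0 : E2) ρ) :=
    isCompact_Icc.prod (isCompact_closedBall _ _)
  obtain ⟨M, hM⟩ := hK.exists_bound_of_continuousOn hc.continuousOn
  refine hasDerivAt_integral_of_dominated_loc_of_deriv_le
    (F := fun s x => G (s, x)) (F' := fun s x => ptD G (s, x))
    (bound := (Metric.closedBall (0 : E2) ρ).indicator fun _ => M)
    (s := Metric.ball t ε) (Metric.ball_mem_nhds t hε) ?_ ?_ ?_ ?_ ?_ ?_
  · exact Filter.Eventually.of_forall fun s =>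
      (hG.continuous.comp (by fun_prop : Continuous fun x : E2 => (s, x))).aestronglyMeasurable
  · refine (hG.continuous.comp
      (by fun_prop : Continuous fun x : E2 => (t, x))).integrable_of_hasCompactSupport ?_
    refine HasCompactSupport.intro (isCompact_closedBall (0 : E2) ρ) fun x hx => ?_
    exact h0 t (by simpa using hε) x (by simpa using (not_le.1 (by simpa using hx)).le)
  · exact (hc.comp (by fun_prop : Continuous fun x : E2 => (t, x))).aestronglyMeasurable
  · refine Filter.Eventually.of_forall fun x s hs => ?_
    rw [Metric.mem_ball, Real.dist_eq] at hs
    by_cases hx : x ∈ Metric.closedBall (0 : E2) ρ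
    · rw [Set.indicator_of_mem hx]
      refine hM _ ⟨?_, hx⟩
      constructor <;> linarith [abs_lt.1 hs]
    · rw [Set.indicator_of_notMem hx]
      have hx' : ρ ≤ ‖x‖ := (not_le.1 (by simpa using hx)).le
      have hz : (fun s => G (s, x)) =ᶠ[nhds s] fun _ => 0 := by
        filter_upwards [(isOpen_lt (by fun_prop : Continuous fun r : ℝ => |r - t|)
          continuous_const).mem_nhds hs] with r hr
        exact h0 r hr x hx'
      rw [← (hd s x).deriv, hz.deriv_eq]
      simp
  · exact (integrable_indicator_iff measurableSet_closedBall).2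
      (integrableOn_const (by exact measure_closedBall_lt_top.ne))
  · exact Filter.Eventually.of_forall fun x s _ => hd s x

lemma fderiv_slice {G : ℝ × E2 → ℝ} (hG : ContDiff ℝ (⊤ : ℕ∞) G) (s : ℝ) (x : E2) (i : Fin 2) :
    fderiv ℝ (fun y => G (s, y)) x (EuclideanSpace.single i 1) = pxD i G (s, x) := by
  have h := ((hG.differentiable (by simp) (s, x)).hasFDerivAt).comp x
    ((hasFDerivAt_const s x).prodMk (hasFDerivAt_id x))
  rw [HasFDerivAt.fderiv (f := fun y => G (s, y)) h]
  simp [pxD]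

lemma integral_pxD_eq_zero {G : ℝ × E2 → ℝ} (hG : ContDiff ℝ (⊤ : ℕ∞) G) {s ρ : ℝ} (i : Fin 2)
    (h0 : ∀ x : E2, ρ ≤ ‖x‖ → G (s, x) = 0) :
    Integrable (fun x : E2 => pxD i G (s, x)) ∧ ∫ x : E2, pxD i G (s, x) = 0 := by
  have hs : HasCompactSupport fun x : E2 => G (s, x) :=
    HasCompactSupport.intro (isCompact_closedBall (0 : E2) ρ) fun x hx =>
      h0 x (not_le.1 (by simpa using hx)).le
  have hsm : ContDiff ℝ (⊤ : ℕ∞) fun x : E2 => G (s, x) := hG.comp (by fun_prop)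
  have hcont : Continuous fun x : E2 => pxD i G (s, x) :=
    (contDiff_pxD hG i).continuous.comp (by fun_prop)
  have hint : Integrable fun x : E2 => pxD i G (s, x) := by
    refine hcont.integrable_of_hasCompactSupport ?_
    have := hs.fderiv_apply (𝕜 := ℝ) (EuclideanSpace.single i (1:ℝ))
    simpa only [fderiv_slice hG] using this
  refine ⟨hint, ?_⟩
  have := integral_mul_fderiv_eq_neg_fderiv_mul_of_integrable (μ := (volume : Measure E2))
    (f := fun _ : E2 => (1 : ℝ)) (g := fun x : E2 => G (s, x)) (v := EuclideanSpace.single i 1)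
    (by simp) (by simpa [fderiv_slice hG] using hint)
    (by simpa using hsm.continuous.integrable_of_hasCompactSupport hs)
    (by fun_prop) (fun x _ => hsm.differentiable (by simp) x)
  simpa [fderiv_slice hG] using this

lemma fderiv_mul_eval {f g : ℝ × E2 → ℝ} (hf : ContDiff ℝ (⊤ : ℕ∞) f)
    (hg : ContDiff ℝ (⊤ : ℕ∞) g) (p v : ℝ × E2) :
    fderiv ℝ (fun q => f q * g q) p v = fderiv ℝ f p v * g p + f p * fderiv ℝ g p v := by
  rw [fderiv_fun_mul (hf.differentiable (by simp) p) (hg.differentiable (by simp) p)]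
  simp
  ring

lemma fderiv_inner_eval {m : ℕ} {f g : ℝ × E2 → Em m} (hf : ContDiff ℝ (⊤ : ℕ∞) f)
    (hg : ContDiff ℝ (⊤ : ℕ∞) g) (p v : ℝ × E2) :
    fderiv ℝ (fun q => ⟪f q, g q⟫) p v = ⟪fderiv ℝ f p v, g p⟫ + ⟪f p, fderiv ℝ g p v⟫ := by
  rw [fderiv_inner_apply ℝ (hf.differentiable (by simp) p) (hg.differentiable (by simp) p)]
  ring

lemma fderiv_add_eval {f g : ℝ × E2 → ℝ} (hf : ContDiff ℝ (⊤ : ℕ∞) f)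
    (hg : ContDiff ℝ (⊤ : ℕ∞) g) (p v : ℝ × E2) :
    fderiv ℝ (fun q => f q + g q) p v = fderiv ℝ f p v + fderiv ℝ g p v := by
  rw [fderiv_fun_add (hf.differentiable (by simp) p) (hg.differentiable (by simp) p)]
  rfl

lemma fderiv_sub_eval {f g : ℝ × E2 → ℝ} (hf : ContDiff ℝ (⊤ : ℕ∞) f)
    (hg : ContDiff ℝ (⊤ : ℕ∞) g) (p v : ℝ × E2) :
    fderiv ℝ (fun q => f q - g q) p v = fderiv ℝ f p v - fderiv ℝ g p v := by
  rw [fderiv_fun_sub (hf.differentiable (by simp) p) (hg.differentiable (by simp) p)]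
  rfl

lemma inner_fderiv_eq_zero_of_norm_eq_one {m : ℕ} {φ : ℝ × E2 → Em m}
    (hφ : ContDiff ℝ (⊤ : ℕ∞) φ) (h1 : ∀ p, ‖φ p‖ = 1) (p v : ℝ × E2) :
    ⟪φ p, fderiv ℝ φ p v⟫ = 0 := by
  have h : fderiv ℝ (fun q => ⟪φ q, φ q⟫) p v = 0 := by simp [h1]
  rw [fderiv_inner_eval hφ hφ, real_inner_comm] at h
  linarith

/-- The nonlinearity of the wave map equation is orthogonal to every derivative of the map. -/
lemma inner_ptD_ptD_fderiv {m : ℕ} {φ : ℝ × E2 → Em m}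
    (hφ : ContDiff ℝ (⊤ : ℕ∞) φ) (h1 : ∀ p, ‖φ p‖ = 1)
    (hw : ∀ p, boxD φ p = -(nullf m φ p) • φ p) (p v : ℝ × E2) :
    ⟪ptD (ptD φ) p, fderiv ℝ φ p v⟫ =
      ⟪pxD 0 (pxD 0 φ) p, fderiv ℝ φ p v⟫ + ⟪pxD 1 (pxD 1 φ) p, fderiv ℝ φ p v⟫ := by
  have h : ⟪boxD φ p, fderiv ℝ φ p v⟫ = 0 := by
    rw [hw p, inner_smul_left, inner_fderiv_eq_zero_of_norm_eq_one hφ h1, mul_zero]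
  rw [boxD, Fin.sum_univ_two, inner_add_left, inner_neg_left, inner_add_left] at h
  change -⟪ptD (ptD φ) p, _⟫ + (⟪pxD 0 (pxD 0 φ) p, _⟫ + ⟪pxD 1 (pxD 1 φ) p, _⟫) = 0 at h
  linarith

/-- Energy identity with a space-time weight. -/
lemma ptD_energy_mul {m : ℕ} {φ : ℝ × E2 → Em m}
    (hφ : ContDiff ℝ (⊤ : ℕ∞) φ) (h1 : ∀ p, ‖φ p‖ = 1)
    (hw : ∀ p, boxD φ p = -(nullf m φ p) • φ p)
    {w : ℝ × E2 → ℝ} (hws : ContDiff ℝ (⊤ : ℕ∞) w) (p : ℝ × E2) :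
    ptD (fun q => (⟪ptD φ q, ptD φ q⟫ + ⟪pxD 0 φ q, pxD 0 φ q⟫ + ⟪pxD 1 φ q, pxD 1 φ q⟫) * w q) p =
      2 * pxD 0 (fun q => ⟪ptD φ q, pxD 0 φ q⟫ * w q) p
      + 2 * pxD 1 (fun q => ⟪ptD φ q, pxD 1 φ q⟫ * w q) p
      - 2 * (⟪ptD φ p, pxD 0 φ p⟫ * pxD 0 w p + ⟪ptD φ p, pxD 1 φ p⟫ * pxD 1 w p)
      + (⟪ptD φ p, ptD φ p⟫ + ⟪pxD 0 φ p, pxD 0 φ p⟫ + ⟪pxD 1 φ p, pxD 1 φ p⟫) * ptD w p := by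
  have ha := contDiff_ptD hφ
  have hb := contDiff_pxD hφ
  have hW := inner_ptD_ptD_fderiv hφ h1 hw p (1, 0)
  have e0 := pxD_ptD hφ 0 p
  have e1 := pxD_ptD hφ 1 p
  have haa := ha.inner ℝ ha
  have h00 := (hb 0).inner ℝ (hb 0)
  have h11 := (hb 1).inner ℝ (hb 1)
  have ha0 := ha.inner ℝ (hb 0)
  have ha1 := ha.inner ℝ (hb 1)
  change ⟪ptD (ptD φ) p, ptD φ p⟫ = ⟪pxD 0 (pxD 0 φ) p, ptD φ p⟫ + ⟪pxD 1 (pxD 1 φ) p, ptD φ p⟫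
    at hW
  have L : ptD (fun q => (⟪ptD φ q, ptD φ q⟫ + ⟪pxD 0 φ q, pxD 0 φ q⟫
      + ⟪pxD 1 φ q, pxD 1 φ q⟫) * w q) p =
      (⟪ptD (ptD φ) p, ptD φ p⟫ + ⟪ptD φ p, ptD (ptD φ) p⟫
        + (⟪ptD (pxD 0 φ) p, pxD 0 φ p⟫ + ⟪pxD 0 φ p, ptD (pxD 0 φ) p⟫)
        + (⟪ptD (pxD 1 φ) p, pxD 1 φ p⟫ + ⟪pxD 1 φ p, ptD (pxD 1 φ) p⟫)) * w p
      + (⟪ptD φ p, ptD φ p⟫ + ⟪pxD 0 φ p, pxD 0 φ p⟫ + ⟪pxD 1 φ p, pxD 1 φ p⟫) * ptD w p := by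
    rw [ptD, fderiv_mul_eval ((haa.add h00).add h11) hws, fderiv_add_eval (haa.add h00) h11,
      fderiv_add_eval haa h00, fderiv_inner_eval ha ha, fderiv_inner_eval (hb 0) (hb 0),
      fderiv_inner_eval (hb 1) (hb 1)]
    rfl
  have X : ∀ i, pxD i (fun q => ⟪ptD φ q, pxD i φ q⟫ * w q) p =
      (⟪pxD i (ptD φ) p, pxD i φ p⟫ + ⟪ptD φ p, pxD i (pxD i φ) p⟫) * w p
      + ⟪ptD φ p, pxD i φ p⟫ * pxD i w p := by
    intro i
    rw [pxD, fderiv_mul_eval (ha.inner ℝ (hb i)) hws, fderiv_inner_eval ha (hb i)]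
    rfl
  rw [L, X, X, e0, e1, real_inner_comm (ptD (ptD φ) p), real_inner_comm (ptD (pxD 0 φ) p),
    real_inner_comm (ptD (pxD 1 φ) p), real_inner_comm (pxD 0 (pxD 0 φ) p),
    real_inner_comm (pxD 1 (pxD 1 φ) p)]
  simp only [real_inner_comm] at hW ⊢
  linear_combination 2 * w p * hW

/-- The flux in direction `j` of the momentum weighted by the vector field `g`. -/
def momentumFlux {m : ℕ} (φ : ℝ × E2 → Em m) (g : Fin 2 → ℝ × E2 → ℝ) (j : Fin 2)
    (q : ℝ × E2) : ℝ :=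
  g 0 q * ⟪pxD j φ q, pxD 0 φ q⟫ + g 1 q * ⟪pxD j φ q, pxD 1 φ q⟫
    + 1 / 2 * g j q * (⟪ptD φ q, ptD φ q⟫ - ⟪pxD 0 φ q, pxD 0 φ q⟫ - ⟪pxD 1 φ q, pxD 1 φ q⟫)

/-- What is left of the time derivative of the weighted momentum besides the flux. -/
def momentumSource {m : ℕ} (φ : ℝ × E2 → Em m) (g : Fin 2 → ℝ × E2 → ℝ) (p : ℝ × E2) : ℝ :=
  -(pxD 0 (g 0) p * ⟪pxD 0 φ p, pxD 0 φ p⟫ + pxD 0 (g 1) p * ⟪pxD 0 φ p, pxD 1 φ p⟫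
      + pxD 1 (g 0) p * ⟪pxD 1 φ p, pxD 0 φ p⟫ + pxD 1 (g 1) p * ⟪pxD 1 φ p, pxD 1 φ p⟫)
    - 1 / 2 * (pxD 0 (g 0) p + pxD 1 (g 1) p)
      * (⟪ptD φ p, ptD φ p⟫ - ⟪pxD 0 φ p, pxD 0 φ p⟫ - ⟪pxD 1 φ p, pxD 1 φ p⟫)

lemma contDiff_momentumFlux {m : ℕ} {φ : ℝ × E2 → Em m} (hφ : ContDiff ℝ (⊤ : ℕ∞) φ)
    {g : Fin 2 → ℝ × E2 → ℝ} (hg : ∀ i, ContDiff ℝ (⊤ : ℕ∞) (g i)) (j : Fin 2) :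
    ContDiff ℝ (⊤ : ℕ∞) (momentumFlux φ g j) := by
  have ha := contDiff_ptD hφ
  have hb := contDiff_pxD hφ
  exact (((hg 0).mul ((hb j).inner ℝ (hb 0))).add ((hg 1).mul ((hb j).inner ℝ (hb 1)))).add
    ((contDiff_const.mul (hg j)).mul
      (((ha.inner ℝ ha).sub ((hb 0).inner ℝ (hb 0))).sub ((hb 1).inner ℝ (hb 1))))

/-- Momentum identity with a time-independent vector field as weight. -/
lemma ptD_momentum {m : ℕ} {φ : ℝ × E2 → Em m}
    (hφ : ContDiff ℝ (⊤ : ℕ∞) φ) (h1 : ∀ p, ‖φ p‖ = 1)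
    (hw : ∀ p, boxD φ p = -(nullf m φ p) • φ p)
    {g : Fin 2 → ℝ × E2 → ℝ} (hg : ∀ i, ContDiff ℝ (⊤ : ℕ∞) (g i))
    (p : ℝ × E2) (hg0 : ∀ i, ptD (g i) p = 0) :
    ptD (fun q => g 0 q * ⟪ptD φ q, pxD 0 φ q⟫ + g 1 q * ⟪ptD φ q, pxD 1 φ q⟫) p =
      pxD 0 (momentumFlux φ g 0) p + pxD 1 (momentumFlux φ g 1) p + momentumSource φ g p := by
  have ha := contDiff_ptD hφ
  have hb := contDiff_pxD hφ
  have hW : ∀ i, ⟪ptD (ptD φ) p, pxD i φ p⟫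
      = ⟪pxD 0 (pxD 0 φ) p, pxD i φ p⟫ + ⟪pxD 1 (pxD 1 φ) p, pxD i φ p⟫ := fun i =>
    inner_ptD_ptD_fderiv hφ h1 hw p _
  have haa := ha.inner ℝ ha
  have hbb := fun i j => (hb i).inner ℝ (hb j)
  have hab := fun i => ha.inner ℝ (hb i)
  have L : ptD (fun q => g 0 q * ⟪ptD φ q, pxD 0 φ q⟫ + g 1 q * ⟪ptD φ q, pxD 1 φ q⟫) p =
      ptD (g 0) p * ⟪ptD φ p, pxD 0 φ p⟫
        + g 0 p * (⟪ptD (ptD φ) p, pxD 0 φ p⟫ + ⟪ptD φ p, ptD (pxD 0 φ) p⟫)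
      + (ptD (g 1) p * ⟪ptD φ p, pxD 1 φ p⟫
        + g 1 p * (⟪ptD (ptD φ) p, pxD 1 φ p⟫ + ⟪ptD φ p, ptD (pxD 1 φ) p⟫)) := by
    rw [ptD, fderiv_add_eval ((hg 0).mul (hab 0)) ((hg 1).mul (hab 1)),
      fderiv_mul_eval (hg 0) (hab 0), fderiv_mul_eval (hg 1) (hab 1),
      fderiv_inner_eval ha (hb 0), fderiv_inner_eval ha (hb 1)]
    rfl
  have X : ∀ j, pxD j (momentumFlux φ g j) p =
      pxD j (g 0) p * ⟪pxD j φ p, pxD 0 φ p⟫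
        + g 0 p * (⟪pxD j (pxD j φ) p, pxD 0 φ p⟫ + ⟪pxD j φ p, pxD j (pxD 0 φ) p⟫)
      + (pxD j (g 1) p * ⟪pxD j φ p, pxD 1 φ p⟫
        + g 1 p * (⟪pxD j (pxD j φ) p, pxD 1 φ p⟫ + ⟪pxD j φ p, pxD j (pxD 1 φ) p⟫))
      + (1 / 2 * pxD j (g j) p
          * (⟪ptD φ p, ptD φ p⟫ - ⟪pxD 0 φ p, pxD 0 φ p⟫ - ⟪pxD 1 φ p, pxD 1 φ p⟫)
        + 1 / 2 * g j p * (⟪pxD j (ptD φ) p, ptD φ p⟫ + ⟪ptD φ p, pxD j (ptD φ) p⟫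
          - (⟪pxD j (pxD 0 φ) p, pxD 0 φ p⟫ + ⟪pxD 0 φ p, pxD j (pxD 0 φ) p⟫)
          - (⟪pxD j (pxD 1 φ) p, pxD 1 φ p⟫ + ⟪pxD 1 φ p, pxD j (pxD 1 φ) p⟫))) := by
    intro j
    have hc : fderiv ℝ (fun q => 1 / 2 * g j q) p (0, EuclideanSpace.single j 1)
        = 1 / 2 * pxD j (g j) p := by
      rw [fderiv_mul_eval contDiff_const (hg j)]
      simp [pxD]
    unfold momentumFlux
    rw [pxD, fderiv_add_eval (((hg 0).mul (hbb j 0)).add ((hg 1).mul (hbb j 1)))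
        ((contDiff_const.mul (hg j)).mul ((haa.sub (hbb 0 0)).sub (hbb 1 1))),
      fderiv_add_eval ((hg 0).mul (hbb j 0)) ((hg 1).mul (hbb j 1)),
      fderiv_mul_eval (hg 0) (hbb j 0), fderiv_mul_eval (hg 1) (hbb j 1),
      fderiv_mul_eval (contDiff_const.mul (hg j)) ((haa.sub (hbb 0 0)).sub (hbb 1 1)), hc,
      fderiv_sub_eval (haa.sub (hbb 0 0)) (hbb 1 1), fderiv_sub_eval haa (hbb 0 0),
      fderiv_inner_eval (hb j) (hb 0), fderiv_inner_eval (hb j) (hb 1),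
      fderiv_inner_eval ha ha, fderiv_inner_eval (hb 0) (hb 0), fderiv_inner_eval (hb 1) (hb 1)]
    rfl
  rw [L, X, X, hW, hW, hg0, hg0, pxD_ptD hφ, pxD_ptD hφ, pxD_pxD hφ 1 0, momentumSource]
  rw [real_inner_comm (ptD φ p) (ptD (pxD 0 φ) p), real_inner_comm (ptD φ p) (ptD (pxD 1 φ) p),
    real_inner_comm (pxD 0 φ p) (pxD 0 (pxD 0 φ) p),
    real_inner_comm (pxD 1 φ p) (pxD 1 (pxD 1 φ) p),
    real_inner_comm (pxD 0 φ p) (pxD 0 (pxD 1 φ) p),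
    real_inner_comm (pxD 1 φ p) (pxD 0 (pxD 1 φ) p)]
  ring

/-- A smooth weight, positive exactly where `‖x - x₀‖ < |r - (s - t₀)|`. -/
def coneWeight (t₀ r : ℝ) (x₀ : E2) (q : ℝ × E2) : ℝ :=
  expNegInvGlue ((r - (q.1 - t₀)) ^ 2 - ‖q.2 - x₀‖ ^ 2)

lemma contDiff_coneWeight (t₀ r : ℝ) (x₀ : E2) : ContDiff ℝ (⊤ : ℕ∞) (coneWeight t₀ r x₀) :=
  expNegInvGlue.contDiff.comp
    (((contDiff_const.sub (contDiff_fst.sub contDiff_const)).pow 2).sub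
      ((contDiff_snd.sub contDiff_const).norm_sq ℝ))

lemma fderiv_coneWeight (t₀ r : ℝ) (x₀ : E2) (q v : ℝ × E2) :
    fderiv ℝ (coneWeight t₀ r x₀) q v =
      deriv expNegInvGlue ((r - (q.1 - t₀)) ^ 2 - ‖q.2 - x₀‖ ^ 2)
        * (-2 * (r - (q.1 - t₀)) * v.1 - 2 * ⟪q.2 - x₀, v.2⟫) := by
  have h1 : HasFDerivAt (fun q : ℝ × E2 => r - (q.1 - t₀)) (-(ContinuousLinearMap.fst ℝ ℝ E2)) q :=
    (hasFDerivAt_fst.sub_const t₀).const_sub r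
  have h2 : HasFDerivAt (fun q : ℝ × E2 => q.2 - x₀) (ContinuousLinearMap.snd ℝ ℝ E2) q :=
    hasFDerivAt_snd.sub_const x₀
  have hψ : HasDerivAt expNegInvGlue _ ((r - (q.1 - t₀)) ^ 2 - ‖q.2 - x₀‖ ^ 2) :=
    ((expNegInvGlue.contDiff (n := 1)).differentiable (by simp) _).hasDerivAt
  have h := hψ.comp_hasFDerivAt q ((h1.pow 2).sub h2.norm_sq)
  rw [HasFDerivAt.fderiv (f := coneWeight t₀ r x₀) h]
  simp [-map_sub]

lemma coneWeight_eq_zero {t₀ r : ℝ} {x₀ : E2} {q : ℝ × E2} (h : |r - (q.1 - t₀)| ≤ ‖q.2 - x₀‖) :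
    coneWeight t₀ r x₀ q = 0 := by
  refine expNegInvGlue.zero_of_nonpos ?_
  have := sq_le_sq' (by linarith [abs_nonneg (r - (q.1 - t₀)), norm_nonneg (q.2 - x₀)]) h
  rw [sq_abs] at this
  linarith

lemma coneWeight_flux_le {m : ℕ} (a b₀ b₁ : Em m) {t₀ r : ℝ} {x₀ : E2} {q : ℝ × E2}
    (hq : q.1 - t₀ ≤ r) :
    -2 * (⟪a, b₀⟫ * pxD 0 (coneWeight t₀ r x₀) q + ⟪a, b₁⟫ * pxD 1 (coneWeight t₀ r x₀) q)
      + (⟪a, a⟫ + ⟪b₀, b₀⟫ + ⟪b₁, b₁⟫) * ptD (coneWeight t₀ r x₀) q ≤ 0 := by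
  rw [pxD, pxD, ptD, fderiv_coneWeight, fderiv_coneWeight, fderiv_coneWeight]
  set z := (r - (q.1 - t₀)) ^ 2 - ‖q.2 - x₀‖ ^ 2 with hz
  have hψ : 0 ≤ deriv expNegInvGlue z := expNegInvGlue.monotone.deriv_nonneg
  rcases lt_or_ge z 0 with hneg | hpos
  · have : deriv expNegInvGlue z = 0 := by
      have : expNegInvGlue =ᶠ[nhds z] fun _ => 0 := by
        filter_upwards [Iio_mem_nhds hneg] with y hy
        exact expNegInvGlue.zero_of_nonpos (le_of_lt hy)
      rw [this.deriv_eq]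
      simp
    simp [this]
  · set y := q.2 - x₀
    have hτ : 0 ≤ r - (q.1 - t₀) := by linarith
    set τ := r - (q.1 - t₀)
    have hy : ‖y‖ ≤ τ := by
      refine abs_le_of_sq_le_sq' (by linarith) hτ |>.2
    have hn : ‖y‖ ^ 2 = y 0 ^ 2 + y 1 ^ 2 := by
      simp [EuclideanSpace.norm_sq_eq, Fin.sum_univ_two]
    have key : 2 * (y 0 * ⟪a, b₀⟫ + y 1 * ⟪a, b₁⟫) ≤ τ * (⟪a, a⟫ + ⟪b₀, b₀⟫ + ⟪b₁, b₁⟫) := by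
      have e : y 0 * ⟪a, b₀⟫ + y 1 * ⟪a, b₁⟫ = ⟪a, y 0 • b₀ + y 1 • b₁⟫ := by
        simp [inner_add_right, inner_smul_right]
      have hv : ‖y 0 • b₀ + y 1 • b₁‖ ^ 2 ≤ ‖y‖ ^ 2 * (‖b₀‖ ^ 2 + ‖b₁‖ ^ 2) := by
        have h3 : ‖y 0 • b₀ + y 1 • b₁‖ ≤ |y 0| * ‖b₀‖ + |y 1| * ‖b₁‖ := by
          refine (norm_add_le _ _).trans ?_
          simp [norm_smul]
        have h4 := pow_le_pow_left₀ (norm_nonneg _) h3 2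
        rw [hn, ← sq_abs (y 0), ← sq_abs (y 1)]
        nlinarith [sq_nonneg (|y 0| * ‖b₁‖ - |y 1| * ‖b₀‖)]
      have hB : (0 : ℝ) ≤ ‖b₀‖ ^ 2 + ‖b₁‖ ^ 2 := by positivity
      have hv' : ‖y 0 • b₀ + y 1 • b₁‖ ≤ τ * √(‖b₀‖ ^ 2 + ‖b₁‖ ^ 2) := by
        refine abs_le_of_sq_le_sq' ?_ (by positivity) |>.2
        rw [mul_pow, Real.sq_sqrt hB]
        refine hv.trans (mul_le_mul_of_nonneg_right ?_ hB)
        exact pow_le_pow_left₀ (norm_nonneg _) hy 2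
      have hcs := real_inner_le_norm a (y 0 • b₀ + y 1 • b₁)
      have h5 := mul_le_mul_of_nonneg_left hv' (norm_nonneg a)
      rw [e]
      simp only [real_inner_self_eq_norm_sq]
      nlinarith [mul_nonneg hτ (sq_nonneg (‖a‖ - √(‖b₀‖ ^ 2 + ‖b₁‖ ^ 2))), Real.sq_sqrt hB]
    have i0 : ⟪y, EuclideanSpace.single (0 : Fin 2) (1 : ℝ)⟫ = y 0 := by
      simp [EuclideanSpace.inner_single_right]
    have i1 : ⟪y, EuclideanSpace.single (1 : Fin 2) (1 : ℝ)⟫ = y 1 := by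
      simp [EuclideanSpace.inner_single_right]
    simp only [i0, i1, inner_zero_right, mul_zero, zero_sub, sub_zero, mul_one]
    nlinarith [mul_le_mul_of_nonneg_left key hψ]

/-- Domain of dependence: the derivatives of a wave map vanish at the tip of a cone over a ball
where they vanish initially. -/
lemma derivs_eq_zero_of_eq_zero_on_ball {m : ℕ} {φ : ℝ × E2 → Em m}
    (hφ : ContDiff ℝ (⊤ : ℕ∞) φ) (h1 : ∀ p, ‖φ p‖ = 1)
    (hw : ∀ p, boxD φ p = -(nullf m φ p) • φ p) {t₀ t₁ r : ℝ} {x₀ : E2}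
    (h0 : ∀ x, ‖x - x₀‖ < r → ptD φ (t₀, x) = 0 ∧ ∀ i, pxD i φ (t₀, x) = 0)
    (ht : t₀ ≤ t₁) (ht' : t₁ - t₀ < r) :
    ptD φ (t₁, x₀) = 0 ∧ ∀ i, pxD i φ (t₁, x₀) = 0 := by
  have ha := contDiff_ptD hφ
  have hb := contDiff_pxD hφ
  have hws := contDiff_coneWeight t₀ r x₀
  set w := coneWeight t₀ r x₀ with hwdef
  set G : ℝ × E2 → ℝ := fun q =>
    (⟪ptD φ q, ptD φ q⟫ + ⟪pxD 0 φ q, pxD 0 φ q⟫ + ⟪pxD 1 φ q, pxD 1 φ q⟫) * w q with hG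
  have hGs : ContDiff ℝ (⊤ : ℕ∞) G :=
    (((ha.inner ℝ ha).add ((hb 0).inner ℝ (hb 0))).add ((hb 1).inner ℝ (hb 1))).mul hws
  have hw0 : ∀ s s', |s' - s| < 1 → ∀ x : E2, ‖x₀‖ + |r - (s - t₀)| + 1 ≤ ‖x‖ →
      w (s', x) = 0 := by
    intro s s' hs x hx
    refine coneWeight_eq_zero ?_
    have e1 : |r - (s' - t₀)| ≤ |r - (s - t₀)| + |s' - s| := by
      have := abs_sub (r - (s - t₀)) (s' - s)
      rwa [show r - (s - t₀) - (s' - s) = r - (s' - t₀) by ring] at this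
    have e2 := norm_sub_norm_le x x₀
    dsimp only
    linarith
  have hw00 : ∀ s, ∀ x : E2, ‖x₀‖ + |r - (s - t₀)| + 1 ≤ ‖x‖ → w (s, x) = 0 :=
    fun s => hw0 s s (by simp)
  have hder : ∀ s, Integrable (fun x : E2 => ptD G (s, x)) ∧
      HasDerivAt (fun s => ∫ x : E2, G (s, x)) (∫ x : E2, ptD G (s, x)) s := fun s =>
    hasDerivAt_integral_slice (ρ := ‖x₀‖ + |r - (s - t₀)| + 1) hGs one_pos
      fun s' hs x hx => by simp [hG, hw0 s s' hs x hx]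
  have hneg : ∀ s, s - t₀ ≤ r → ∫ x : E2, ptD G (s, x) ≤ 0 := by
    intro s hs
    have X : ∀ i, Integrable (fun x : E2 => pxD i (fun q => ⟪ptD φ q, pxD i φ q⟫ * w q) (s, x)) ∧
        ∫ x : E2, pxD i (fun q => ⟪ptD φ q, pxD i φ q⟫ * w q) (s, x) = 0 := fun i =>
      integral_pxD_eq_zero (ρ := ‖x₀‖ + |r - (s - t₀)| + 1)
        ((ha.inner ℝ (hb i)).mul hws) i fun x hx => by
        simp [hw00 s x hx]
    have : ∫ x : E2, ptD G (s, x) ≤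
        ∫ x : E2, (2 * pxD 0 (fun q => ⟪ptD φ q, pxD 0 φ q⟫ * w q) (s, x)
          + 2 * pxD 1 (fun q => ⟪ptD φ q, pxD 1 φ q⟫ * w q) (s, x)) := by
      refine integral_mono (hder s).1 (((X 0).1.const_mul 2).add ((X 1).1.const_mul 2)) fun x => ?_
      have hE := ptD_energy_mul hφ h1 hw hws (s, x)
      have hF := coneWeight_flux_le (ptD φ (s, x)) (pxD 0 φ (s, x)) (pxD 1 φ (s, x))
        (t₀ := t₀) (r := r) (x₀ := x₀) (q := (s, x)) hs
      rw [← hwdef] at hF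
      simp only [hG]
      linarith
    rw [integral_add ((X 0).1.const_mul 2) ((X 1).1.const_mul 2), integral_const_mul,
      integral_const_mul, (X 0).2, (X 1).2] at this
    simpa using this
  have hanti : AntitoneOn (fun s => ∫ x : E2, G (s, x)) (Set.Icc t₀ t₁) := by
    refine antitoneOn_of_deriv_nonpos (convex_Icc _ _)
      (fun s _ => (hder s).2.continuousAt.continuousWithinAt)
      (fun s _ => (hder s).2.differentiableAt.differentiableWithinAt) fun s hs => ?_
    rw [interior_Icc] at hs
    rw [(hder s).2.deriv]
    exact hneg s (by linarith [hs.2])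
  have hle : ∫ x : E2, G (t₁, x) ≤ ∫ x : E2, G (t₀, x) :=
    hanti (Set.left_mem_Icc.2 ht) (Set.right_mem_Icc.2 ht) ht
  have hinit : ∀ x, G (t₀, x) = 0 := by
    intro x
    rcases lt_or_ge ‖x - x₀‖ r with hx | hx
    · simp [hG, (h0 x hx).1, (h0 x hx).2]
    · have : w (t₀, x) = 0 := coneWeight_eq_zero (by
        simpa [abs_of_nonneg (show 0 ≤ r by linarith)] using hx)
      simp [hG, this]
  have hnn : ∀ q, 0 ≤ G q := fun q =>
    mul_nonneg (add_nonneg (add_nonneg real_inner_self_nonneg real_inner_self_nonneg)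
      real_inner_self_nonneg) (expNegInvGlue.nonneg _)
  have hcont : Continuous fun x : E2 => G (t₁, x) := hGs.continuous.comp (by fun_prop)
  have hint : Integrable fun x : E2 => G (t₁, x) := by
    refine hcont.integrable_of_hasCompactSupport
      (HasCompactSupport.intro
        (isCompact_closedBall (0 : E2) (‖x₀‖ + |r - (t₁ - t₀)| + 1)) fun x hx => ?_)
    simp [hG, hw00 t₁ x (not_le.1 (by simpa using hx)).le]
  have hz : ∫ x : E2, G (t₁, x) = 0 :=
    le_antisymm (by simpa [hinit] using hle) (integral_nonneg fun x => hnn _)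
  have hae := (integral_eq_zero_iff_of_nonneg (fun x => hnn (t₁, x)) hint).1 hz
  have hx₀ : G (t₁, x₀) = 0 :=
    congrFun ((hcont.ae_eq_iff_eq volume (continuous_const (y := (0 : ℝ)))).1 hae) x₀
  have hwpos : 0 < w (t₁, x₀) := by
    refine expNegInvGlue.pos_of_pos ?_
    have : 0 < r - (t₁ - t₀) := by linarith
    simpa using pow_pos this 2
  have hs := (mul_eq_zero.1 hx₀).resolve_right hwpos.ne'
  simp only [real_inner_self_eq_norm_sq] at hs
  have n0 := sq_nonneg ‖ptD φ (t₁, x₀)‖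
  have n1 := sq_nonneg ‖pxD 0 φ (t₁, x₀)‖
  have n2 := sq_nonneg ‖pxD 1 φ (t₁, x₀)‖
  refine ⟨by simpa using (show ‖ptD φ (t₁, x₀)‖ ^ 2 = 0 by linarith),
    Fin.forall_fin_two.2 ⟨?_, ?_⟩⟩
  · simpa using (show ‖pxD 0 φ (t₁, x₀)‖ ^ 2 = 0 by linarith)
  · simpa using (show ‖pxD 1 φ (t₁, x₀)‖ ^ 2 = 0 by linarith)

/-- A wave map that is constant near infinity on each time slice has derivatives of compact support
on each time slice. By Baire's theorem the support is bounded locally uniformly in time near a dense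
set of times, and from there it propagates with finite speed. -/
lemma exists_radius_derivs_eq_zero {m : ℕ} {φ : ℝ × E2 → Em m}
    (hφ : ContDiff ℝ (⊤ : ℕ∞) φ) (h1 : ∀ p, ‖φ p‖ = 1)
    (hw : ∀ p, boxD φ p = -(nullf m φ p) • φ p) {p₀ : Em m}
    (hp : ∀ t : ℝ, HasCompactSupport fun x : E2 => φ (t, x) - p₀) (t : ℝ) :
    ∃ ρ : ℝ, ∀ x : E2, ρ ≤ ‖x‖ → ptD φ (t, x) = 0 ∧ ∀ i, pxD i φ (t, x) = 0 := by
  let A : ℕ → Set ℝ := fun n => {s | ∀ x : E2, (n : ℝ) < ‖x‖ → φ (s, x) = p₀}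
  have hA : ∀ n, IsClosed (A n) := by
    intro n
    simp only [A, Set.ofPred_forall]
    refine isClosed_iInter fun x => isClosed_iInter fun _ => ?_
    exact isClosed_eq (hφ.continuous.comp (by fun_prop)) continuous_const
  have hU : ⋃ n, A n = Set.univ := by
    refine Set.eq_univ_of_forall fun s => Set.mem_iUnion.2 ?_
    obtain ⟨ρ, hρ⟩ := (hp s).isCompact.isBounded.subset_closedBall 0
    obtain ⟨n, hn⟩ := exists_nat_ge ρ
    refine ⟨n, fun x hx => sub_eq_zero.1 ?_⟩
    refine image_eq_zero_of_notMem_tsupport (f := fun x : E2 => φ (s, x) - p₀) fun hmem => ?_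
    have := hρ hmem
    rw [mem_closedBall_zero_iff] at this
    linarith
  obtain ⟨t₀, ht₀, hmem⟩ := (dense_iUnion_interior_of_closed hA hU).exists_mem_open
    isOpen_Ioo (Set.nonempty_Ioo.2 (sub_one_lt t))
  obtain ⟨n, hn⟩ := Set.mem_iUnion.1 ht₀
  have hvan : ∀ x : E2, (n : ℝ) < ‖x‖ → ∀ v, fderiv ℝ φ (t₀, x) v = 0 := by
    intro x hx v
    have : φ =ᶠ[nhds (t₀, x)] fun _ => p₀ := by
      have h2 : ∀ᶠ q : ℝ × E2 in nhds (t₀, x), q.1 ∈ interior (A n) :=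
        (isOpen_interior.preimage continuous_fst).mem_nhds hn
      have h3 : ∀ᶠ q : ℝ × E2 in nhds (t₀, x), (n : ℝ) < ‖q.2‖ :=
        (isOpen_lt continuous_const (by fun_prop)).mem_nhds hx
      filter_upwards [h2, h3] with q hq hq'
      exact interior_subset hq q.2 hq'
    rw [this.fderiv_eq]
    simp
  refine ⟨n + 1, fun x hx => ?_⟩
  refine derivs_eq_zero_of_eq_zero_on_ball hφ h1 hw (r := 1) (t₀ := t₀) (fun y hy => ?_)
    hmem.2.le (by linarith [hmem.1])
  have hny : (n : ℝ) < ‖y‖ := by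
    have := norm_sub_norm_le x y
    rw [norm_sub_rev] at this
    linarith
  exact ⟨hvan y hny _, fun i => hvan y hny _⟩

lemma abs_momentumSource_add_le {m : ℕ} {φ : ℝ × E2 → Em m} {g : Fin 2 → ℝ × E2 → ℝ}
    {t M : ℝ} {x : E2} (hM : ∀ i j, |pxD j (g i) (t, x)| ≤ M) :
    |momentumSource φ g (t, x) + ‖ptD φ (t, x)‖ ^ 2| ≤ (3 * M + 1) * eden m φ t x := by
  unfold momentumSource eden
  rw [Fin.sum_univ_two, real_inner_comm (pxD 0 φ (t, x)) (pxD 1 φ (t, x))]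
  simp only [real_inner_self_eq_norm_sq]
  set a := ‖ptD φ (t, x)‖ ^ 2
  set b₀ := ‖pxD 0 φ (t, x)‖ ^ 2
  set b₁ := ‖pxD 1 φ (t, x)‖ ^ 2
  set c := ⟪pxD 0 φ (t, x), pxD 1 φ (t, x)⟫
  have ha : 0 ≤ a := sq_nonneg _
  have h₀ : 0 ≤ b₀ := sq_nonneg _
  have h₁ : 0 ≤ b₁ := sq_nonneg _
  have hM0 : 0 ≤ M := (abs_nonneg _).trans (hM 0 0)
  have hc : |c| ≤ (b₀ + b₁) / 2 := by
    have := abs_real_inner_le_norm (pxD 0 φ (t, x)) (pxD 1 φ (t, x))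
    nlinarith [sq_nonneg (‖pxD 0 φ (t, x)‖ - ‖pxD 1 φ (t, x)‖)]
  have k1 : ∀ i j, ∀ y Y : ℝ, |y| ≤ Y → |pxD j (g i) (t, x) * y| ≤ M * Y := fun i j y Y hy => by
    rw [abs_mul]
    exact mul_le_mul (hM i j) hy (abs_nonneg _) hM0
  have hs : |a - b₀ - b₁| ≤ a + b₀ + b₁ := abs_le.2 ⟨by linarith, by linarith⟩
  have p1 := abs_le.1 (k1 0 0 b₀ b₀ (abs_of_nonneg h₀).le)
  have p2 := abs_le.1 (k1 1 0 c _ hc)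
  have p3 := abs_le.1 (k1 0 1 c _ hc)
  have p4 := abs_le.1 (k1 1 1 b₁ b₁ (abs_of_nonneg h₁).le)
  have p5 := abs_le.1 (k1 0 0 _ _ hs)
  have p6 := abs_le.1 (k1 1 1 _ _ hs)
  have p7 := mul_nonneg hM0 ha
  have p8 := mul_nonneg hM0 h₀
  have p9 := mul_nonneg hM0 h₁
  rw [abs_le]
  constructor <;> nlinarith

/-- The `i`-th component of the cut-off radial vector field, as a function on space-time. -/
def cutoffRadial (χ : E2 → ℝ) (R : ℝ) (i : Fin 2) (q : ℝ × E2) : ℝ :=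
  q.2 i * χ (R⁻¹ • q.2)

lemma contDiff_cutoffRadial {χ : E2 → ℝ} (hχ : ContDiff ℝ (⊤ : ℕ∞) χ) (R : ℝ) (i : Fin 2) :
    ContDiff ℝ (⊤ : ℕ∞) (cutoffRadial χ R i) :=
  ((EuclideanSpace.proj (𝕜 := ℝ) i).contDiff.comp contDiff_snd).mul
    (hχ.comp (contDiff_snd.const_smul R⁻¹))

lemma fderiv_cutoffRadial {χ : E2 → ℝ} (hχ : ContDiff ℝ (⊤ : ℕ∞) χ) (R : ℝ) (i : Fin 2)
    (q v : ℝ × E2) :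
    fderiv ℝ (cutoffRadial χ R i) q v =
      v.2 i * χ (R⁻¹ • q.2) + q.2 i * (R⁻¹ * fderiv ℝ χ (R⁻¹ • q.2) v.2) := by
  have h1 : HasFDerivAt (fun q : ℝ × E2 => q.2 i)
      ((EuclideanSpace.proj (𝕜 := ℝ) i : E2 →L[ℝ] ℝ).comp (ContinuousLinearMap.snd ℝ ℝ E2)) q :=
    (EuclideanSpace.proj (𝕜 := ℝ) i : E2 →L[ℝ] ℝ).hasFDerivAt.comp q hasFDerivAt_snd
  have h2 : HasFDerivAt (fun q : ℝ × E2 => χ (R⁻¹ • q.2)) _ q :=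
    ((hχ.differentiable (by simp) _).hasFDerivAt).comp q (hasFDerivAt_snd.const_smul R⁻¹)
  rw [HasFDerivAt.fderiv (f := cutoffRadial χ R i) (h1.mul h2)]
  simp
  ring

lemma exists_abs_pxD_cutoffRadial_le {χ : E2 → ℝ} (hχs : ContDiff ℝ (⊤ : ℕ∞) χ)
    (hχc : HasCompactSupport χ) (hχb : ∀ x : E2, 0 ≤ χ x ∧ χ x ≤ 1) :
    ∃ M : ℝ, ∀ (R : ℝ) (p : ℝ × E2) (i j : Fin 2), |pxD j (cutoffRadial χ R i) p| ≤ M := by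
  have hc : Continuous (fderiv ℝ χ) := hχs.continuous_fderiv (by simp)
  obtain ⟨K, hK⟩ := (HasCompactSupport.smul_left (f := fun y : E2 => ‖y‖)
    (hχc.fderiv ℝ)).exists_bound_of_continuous (continuous_norm.smul hc)
  refine ⟨1 + K, fun R p i j => ?_⟩
  rw [pxD, fderiv_cutoffRadial hχs]
  set y := R⁻¹ • p.2 with hy
  have e : p.2 i * (R⁻¹ * fderiv ℝ χ y (EuclideanSpace.single j 1)) =
      y i * fderiv ℝ χ y (EuclideanSpace.single j 1) := by
    simp [hy]
    ring
  dsimp only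
  rw [e]
  refine (abs_add_le _ _).trans (add_le_add ?_ ?_)
  · rw [abs_mul, abs_of_nonneg (hχb y).1]
    refine mul_le_one₀ ?_ (hχb y).1 (hχb y).2
    rw [PiLp.single_apply]
    split_ifs <;> simp
  · rw [abs_mul]
    refine le_trans (mul_le_mul (c := |fderiv ℝ χ y (EuclideanSpace.single j 1)|)
      (d := ‖fderiv ℝ χ y‖) (PiLp.norm_apply_le y i) ?_ (abs_nonneg _) (norm_nonneg _))
      ((le_of_eq ?_).trans (hK y))
    · simpa using (fderiv ℝ χ y).le_opNorm (EuclideanSpace.single j 1)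
    · simp [norm_smul]

lemma pxD_cutoffRadial_of_norm_lt {χ : E2 → ℝ} (hχs : ContDiff ℝ (⊤ : ℕ∞) χ)
    (hχ1 : ∀ x : E2, ‖x‖ ≤ 1 → χ x = 1) {R : ℝ} (hR : 0 < R) {p : ℝ × E2} (hp : ‖p.2‖ < R)
    (i j : Fin 2) : pxD j (cutoffRadial χ R i) p = if i = j then 1 else 0 := by
  have hy : ‖R⁻¹ • p.2‖ < 1 := by
    rw [norm_smul, norm_inv, Real.norm_of_nonneg hR.le, inv_mul_lt_iff₀ hR, mul_one]
    exact hp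
  have : χ =ᶠ[nhds (R⁻¹ • p.2)] fun _ => 1 := by
    filter_upwards [(isOpen_lt continuous_norm continuous_const).mem_nhds hy] with z hz
    exact hχ1 z (le_of_lt hz)
  rw [pxD, fderiv_cutoffRadial hχs, this.fderiv_eq, hχ1 _ hy.le]
  simp [PiLp.single_apply]

/-- weighted momentum monotonicity:
`d/dt ∫ Σ_i x_i χ(x/R) ∂_tφ^† ∂_iφ dx = −∫|∂_tφ|² dx + O(r(R))` with
`r(R) = ∫_{|x|≥R} Σ_α |∂_αφ|² dx`, the implied constant depending only on `χ`. -/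
theorem weighted_momentum_monotonicity
    (χ : E2 → ℝ) (hχs : ContDiff ℝ (⊤ : ℕ∞) χ) (hχc : HasCompactSupport χ)
    (hχ1 : ∀ x : E2, ‖x‖ ≤ 1 → χ x = 1) (hχ0 : ∀ x : E2, 2 ≤ ‖x‖ → χ x = 0)
    (hχb : ∀ x : E2, 0 ≤ χ x ∧ χ x ≤ 1) :
    ∃ C > (0:ℝ), ∀ (m : ℕ) (φ : ℝ × E2 → Em m),
      ContDiff ℝ (⊤ : ℕ∞) φ → (∀ p : ℝ × E2, ‖φ p‖ = 1) →
      (∀ p : ℝ × E2, boxD φ p = -(nullf m φ p) • φ p) →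
      (∃ p₀ : Em m, ‖p₀‖ = 1 ∧ ∀ t : ℝ, HasCompactSupport fun x : E2 => φ (t, x) - p₀) →
      ∀ R : ℝ, 0 < R → ∀ t : ℝ, ∃ e : ℝ,
        HasDerivAt
          (fun s => ∫ x : E2, ∑ i : Fin 2, x i * χ (R⁻¹ • x) * ⟪ptD φ (s, x), pxD i φ (s, x)⟫)
          (-(∫ x : E2, ‖ptD φ (t, x)‖^2) + e) t ∧
        |e| ≤ C * ∫ x in {x : E2 | R ≤ ‖x‖}, eden m φ t x := by
  obtain ⟨M, hM⟩ := exists_abs_pxD_cutoffRadial_le hχs hχc hχb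
  have hM0 : 0 ≤ M := (abs_nonneg _).trans (hM 1 0 0 0)
  refine ⟨3 * M + 1, by positivity, ?_⟩
  rintro m φ hφ h1 hw ⟨p₀, -, hp⟩ R hR t
  obtain ⟨ρ, hρ⟩ := exists_radius_derivs_eq_zero hφ h1 hw hp t
  have ha := contDiff_ptD hφ
  have hb := contDiff_pxD hφ
  set g := cutoffRadial χ R
  have hg : ∀ i, ContDiff ℝ (⊤ : ℕ∞) (g i) := contDiff_cutoffRadial hχs R
  have hg0 : ∀ i (s : ℝ) (x : E2), 2 * R ≤ ‖x‖ → g i (s, x) = 0 := by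
    intro i s x hx
    have : 2 ≤ ‖R⁻¹ • x‖ := by
      rw [norm_smul, norm_inv, Real.norm_of_nonneg hR.le, le_inv_mul_iff₀ hR]
      linarith
    simp [g, cutoffRadial, hχ0 _ this]
  have hgt : ∀ i p, ptD (g i) p = 0 := fun i p => by
    rw [ptD, fderiv_cutoffRadial hχs]
    simp
  obtain ⟨hint, hder⟩ := hasDerivAt_integral_slice (t := t) (ρ := 2 * R)
    (((hg 0).mul (ha.inner ℝ (hb 0))).add ((hg 1).mul (ha.inner ℝ (hb 1)))) one_pos
    fun s _ x hx => by simp [hg0 _ s x hx]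
  have X : ∀ j, Integrable (fun x : E2 => pxD j (momentumFlux φ g j) (t, x)) ∧
      ∫ x : E2, pxD j (momentumFlux φ g j) (t, x) = 0 := fun j =>
    integral_pxD_eq_zero (ρ := 2 * R) (contDiff_momentumFlux hφ hg j) j
      fun x hx => by simp [momentumFlux, hg0 _ t x hx]
  have hid : ∀ x : E2, ptD (fun q => g 0 q * ⟪ptD φ q, pxD 0 φ q⟫
      + g 1 q * ⟪ptD φ q, pxD 1 φ q⟫) (t, x) = pxD 0 (momentumFlux φ g 0) (t, x)
      + pxD 1 (momentumFlux φ g 1) (t, x) + momentumSource φ g (t, x) := fun x =>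
    ptD_momentum hφ h1 hw hg (t, x) fun i => hgt i _
  have hflux : Integrable fun x : E2 =>
      pxD 0 (momentumFlux φ g 0) (t, x) + pxD 1 (momentumFlux φ g 1) (t, x) :=
    (X 0).1.add (X 1).1
  have hsrc : Integrable fun x : E2 => momentumSource φ g (t, x) := by
    refine (hint.sub hflux).congr (Filter.Eventually.of_forall fun x => ?_)
    simp only [Pi.sub_apply, hid x]
    ring
  have hval : ∫ x : E2, ptD (fun q => g 0 q * ⟪ptD φ q, pxD 0 φ q⟫
      + g 1 q * ⟪ptD φ q, pxD 1 φ q⟫) (t, x) = ∫ x : E2, momentumSource φ g (t, x) := by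
    simp_rw [hid]
    rw [integral_add hflux hsrc, integral_add (X 0).1 (X 1).1, (X 0).2, (X 1).2]
    ring
  have hsl : Continuous fun x : E2 => (t, x) := by fun_prop
  have hkin : Integrable fun x : E2 => ‖ptD φ (t, x)‖ ^ 2 := by
    refine ((ha.continuous.comp hsl).norm.pow 2).integrable_of_hasCompactSupport
      (HasCompactSupport.intro (isCompact_closedBall (0 : E2) ρ) fun x hx => ?_)
    simp [(hρ x (not_le.1 (by simpa using hx)).le).1]
  have heden : Integrable fun x : E2 => eden m φ t x := by
    refine Continuous.integrable_of_hasCompactSupport ?_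
      (HasCompactSupport.intro (isCompact_closedBall (0 : E2) ρ) fun x hx => ?_)
    · exact ((ha.continuous.comp hsl).norm.pow 2).add
        (continuous_finsetSum _ fun i _ => ((hb i).continuous.comp hsl).norm.pow 2)
    · have := hρ x (not_le.1 (by simpa using hx)).le
      simp [eden, this.1, this.2]
  refine ⟨∫ x : E2, (momentumSource φ g (t, x) + ‖ptD φ (t, x)‖ ^ 2), ?_, ?_⟩
  · rw [integral_add hsrc hkin, neg_add_eq_sub, add_sub_cancel_right, ← hval]
    simpa only [Fin.sum_univ_two] using! hder
  · have hin : ∀ x, x ∉ {x : E2 | R ≤ ‖x‖} →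
        momentumSource φ g (t, x) + ‖ptD φ (t, x)‖ ^ 2 = 0 := by
      intro x hx
      have hD := pxD_cutoffRadial_of_norm_lt hχs hχ1 hR (p := (t, x)) (not_le.1 hx)
      simp only [momentumSource, g, hD, real_inner_self_eq_norm_sq]
      norm_num
      ring
    rw [← setIntegral_eq_integral_of_forall_compl_eq_zero hin, ← integral_const_mul]
    refine norm_integral_le_of_norm_le
      (f := fun x => momentumSource φ g (t, x) + ‖ptD φ (t, x)‖ ^ 2)
      (heden.integrableOn.const_mul _)
      (Filter.Eventually.of_forall fun x => ?_)
    exact abs_momentumSource_add_le fun i j => hM R (t, x) i j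

end
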